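/- A convex polynomial p : ℝⁿ → ℝ whose Hessian is positive definite at a point x₀ is coercive, i.e., p(x) → ∞ as ‖x‖ → ∞. In fact, p is bounded below by the coercive quadratic function x ↦ p(x₀) + (x−x₀)ᵀ∇p(x₀) + (1/(4(d²−1)))(x−x₀)ᵀ∇²p(x₀)(x−x₀), where d is any even integer greater than the degree of the Hessian entries of p. -/

import Mathlib

open MvPolynomial

theorem aux_markov (G : Polynomial ℝ) (N : ℕ) (hN : G.natDegree ≤ N) (M : ℝ) (hM : 0 < M)
    (h0 : ∀ t ∈ Set.Icc (0:ℝ) 1, G.eval 0 ≤ G.eval t ∧ G.eval t ≤ G.eval 0 + M) :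
    (Polynomial.derivative G).eval 0 ≤ N ^ 2 * M := by
  set Q : Polynomial ℝ := Polynomial.C (2 / M) * (Polynomial.C (G.eval 0 + M / 2) -
    G.comp (Polynomial.C (1 / 2) - Polynomial.C (1 / 2) * Polynomial.X)) with hQ
  have hlin : (Polynomial.C (1 / 2 : ℝ) - Polynomial.C (1 / 2) * Polynomial.X).natDegree ≤ 1 := by
    compute_degree
  have hdeg : Q.natDegree ≤ N := by
    refine (Polynomial.natDegree_C_mul_le _ _).trans ?_
    refine (Polynomial.natDegree_sub_le _ _).trans ?_
    simp only [Polynomial.natDegree_C, Nat.zero_le, max_eq_right]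
    refine Polynomial.natDegree_comp_le.trans ?_
    calc _ ≤ G.natDegree * 1 := Nat.mul_le_mul_left _ hlin
      _ ≤ N := by simpa using hN
  have hb : ∀ x ∈ Set.Icc (-1:ℝ) 1, |Q.eval x| ≤ 1 := by
    intro x hx
    have h := h0 (1 / 2 - 1 / 2 * x) ⟨by linarith [hx.2], by linarith [hx.1]⟩
    have : Q.eval x = (2 * (G.eval 0 + M / 2 - G.eval (1 / 2 - 1 / 2 * x))) / M := by
      simp [hQ]; ring
    rw [this, abs_div, abs_of_pos hM, div_le_one hM, abs_le]
    constructor <;> linarith [h.1, h.2]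
  have key := Polynomial.Chebyshev.eval_iterate_derivative_le_of_forall_abs_le_one (n := N) (k := 1)
    (le_refl (1:ℝ)) (Polynomial.natDegree_le_iff_degree_le.mp hdeg) hb
  simp only [Function.iterate_one, Polynomial.Chebyshev.derivative_T_eval_one] at key
  have e : (Polynomial.derivative Q).eval 1 = (Polynomial.derivative G).eval 0 / M := by
    simp [hQ, Polynomial.derivative_comp]; ring
  rw [e, div_le_iff₀ hM] at key
  simpa using key

theorem aux_uni (f : Polynomial ℝ) (hf : ConvexOn ℝ Set.univ (fun t => f.eval t)) (d : ℕ)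
    (hd2 : 2 ≤ d) (hd : (Polynomial.derivative (Polynomial.derivative f)).natDegree < d) :
    1 / (4 * ((d:ℝ)^2 - 1)) * (Polynomial.derivative (Polynomial.derivative f)).eval 0 ≤
      f.eval 1 - f.eval 0 - (Polynomial.derivative f).eval 0 := by
  have hmono : Monotone (fun t => (Polynomial.derivative f).eval t) := by
    have := hf.monotoneOn_deriv (fun x _ => f.differentiable x)
    rw [monotoneOn_univ] at this
    convert this using 2
    simp
  have hnn : ∀ t, 0 ≤ (Polynomial.derivative (Polynomial.derivative f)).eval t := by
    intro t
    have := hmono.deriv_nonneg (x := t)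
    simpa using this
  set G : Polynomial ℝ := (1 - Polynomial.X) * Polynomial.derivative f + f with hG
  have hG' : Polynomial.derivative G =
      (1 - Polynomial.X) * Polynomial.derivative (Polynomial.derivative f) := by
    simp [hG]
  have hGm : MonotoneOn (fun t => G.eval t) (Set.Icc 0 1) := by
    refine monotoneOn_of_deriv_nonneg (convex_Icc 0 1) G.continuous.continuousOn
      G.differentiable.differentiableOn ?_
    intro x hx
    rw [interior_Icc] at hx
    rw [Polynomial.deriv, hG']
    simp only [Polynomial.eval_mul, Polynomial.eval_sub, Polynomial.eval_one, Polynomial.eval_X]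
    exact mul_nonneg (by linarith [hx.2]) (hnn x)
  have hdG : G.natDegree ≤ d + 1 := by
    have h1 : (Polynomial.derivative G).natDegree ≤ d := by
      rw [hG']
      refine Polynomial.natDegree_mul_le.trans ?_
      have : (1 - Polynomial.X : Polynomial ℝ).natDegree ≤ 1 := by compute_degree
      omega
    rw [Polynomial.natDegree_derivative] at h1
    omega
  have hG0 : G.eval 0 = (Polynomial.derivative f).eval 0 + f.eval 0 := by simp [hG]
  have hG1 : G.eval 1 = f.eval 1 := by simp [hG]
  have hGd : (Polynomial.derivative G).eval 0 =
    (Polynomial.derivative (Polynomial.derivative f)).eval 0 := by simp [hG']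
  set M := f.eval 1 - f.eval 0 - (Polynomial.derivative f).eval 0 with hM
  have hM0 : 0 ≤ M := by
    have := hGm (a := 0) (b := 1) (by simp) (by simp) (by norm_num)
    simp only at this
    linarith
  have hb : (Polynomial.derivative G).eval 0 ≤ ((d + 1 : ℕ) : ℝ) ^ 2 * M := by
    have hpos : (0:ℝ) < ((d + 1 : ℕ) : ℝ) ^ 2 := by positivity
    refine le_of_forall_pos_le_add fun ε hε => ?_
    have := aux_markov G (d + 1) hdG (M + ε / ((d + 1 : ℕ) : ℝ) ^ 2) (by positivity) ?_
    · rwa [mul_add, mul_div_cancel₀ _ hpos.ne'] at this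
    · intro t ht
      have h1 := hGm (a := 0) (b := t) (by simp) ht ht.1
      have h2 := hGm (a := t) (b := 1) ht (by simp) ht.2
      have : 0 < ε / ((d + 1 : ℕ) : ℝ) ^ 2 := by positivity
      simp only at h1 h2
      exact ⟨h1, by linarith⟩
  rw [hGd] at hb
  have hdr : (2:ℝ) ≤ d := by exact_mod_cast hd2
  have hpos : (0:ℝ) < 4 * ((d:ℝ)^2 - 1) := by nlinarith
  rw [one_div, inv_mul_le_iff₀ hpos]
  refine hb.trans (mul_le_mul_of_nonneg_right ?_ hM0)
  push_cast
  nlinarith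

theorem aux_chain_gen {n : ℕ} (L : Fin n → Polynomial ℝ) (v : Fin n → ℝ)
    (hL : ∀ i, Polynomial.derivative (L i) = Polynomial.C (v i)) (p : MvPolynomial (Fin n) ℝ) :
    Polynomial.derivative (aeval L p) = ∑ i, Polynomial.C (v i) * aeval L (pderiv i p) := by
  induction p using MvPolynomial.induction_on with
  | C r => simp
  | add p q hp hq => simp [hp, hq, mul_add, Finset.sum_add_distrib]
  | mul_X p j hp =>
    simp only [map_mul, aeval_X]
    rw [Polynomial.derivative_mul, hp, hL]
    have : ∀ i, Polynomial.C (v i) * aeval L (pderiv i (p * X j)) =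
        Polynomial.C (v i) * aeval L (pderiv i p) * L j +
        (if i = j then aeval L p * Polynomial.C (v j) else 0) := by
      intro i
      rw [pderiv_mul]
      by_cases h : i = j
      · subst h
        simp
        ring
      · rw [pderiv_X_of_ne (Ne.symm h)]
        simp [h]
        ring
    simp only [this, Finset.sum_add_distrib, Finset.sum_mul]
    simp

theorem aux_chain {n : ℕ} (a v : Fin n → ℝ) (p : MvPolynomial (Fin n) ℝ) :
    Polynomial.derivative (aeval (fun i => Polynomial.C (a i) + Polynomial.C (v i) * Polynomial.X) p)
     = ∑ i, Polynomial.C (v i) *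
       aeval (fun i => Polynomial.C (a i) + Polynomial.C (v i) * Polynomial.X) (pderiv i p) :=
  aux_chain_gen _ v (fun i => by simp) p

theorem aux_eval {n : ℕ} (a v : Fin n → ℝ) (t : ℝ) (p : MvPolynomial (Fin n) ℝ) :
    Polynomial.eval t
      (aeval (fun i => Polynomial.C (a i) + Polynomial.C (v i) * Polynomial.X) p)
     = eval (fun i => a i + v i * t) p := by
  induction p using MvPolynomial.induction_on with
  | C r => simp
  | add p q hp hq => simp [hp, hq]
  | mul_X p j hp => simp [hp]

theorem aux_lower (n : ℕ) (p : MvPolynomial (Fin n) ℝ)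
    (hconv : ConvexOn ℝ Set.univ (fun x : Fin n → ℝ => eval x p))
    (x₀ : Fin n → ℝ) (d : ℕ) (hd2 : 2 ≤ d)
    (hd : ∀ i j : Fin n, (pderiv i (pderiv j p)).totalDegree < d) (x : Fin n → ℝ) :
      eval x₀ p + (∑ i, eval x₀ (pderiv i p) * (x i - x₀ i))
        + (1 / (4 * ((d:ℝ)^2 - 1))) *
          (∑ i, ∑ j, (x i - x₀ i) * eval x₀ (pderiv i (pderiv j p)) * (x j - x₀ j))
      ≤ eval x p := by
  set v : Fin n → ℝ := fun i => x i - x₀ i with hv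
  set L : Fin n → Polynomial ℝ :=
    fun i => Polynomial.C (x₀ i) + Polynomial.C (v i) * Polynomial.X with hL
  set f : Polynomial ℝ := aeval L p with hf
  have hf1 : Polynomial.derivative f = ∑ i, Polynomial.C (v i) * aeval L (pderiv i p) :=
    aux_chain x₀ v p
  have hf2 : Polynomial.derivative (Polynomial.derivative f) =
      ∑ j, Polynomial.C (v j) * ∑ i, Polynomial.C (v i) * aeval L (pderiv i (pderiv j p)) := by
    rw [hf1, Polynomial.derivative_sum]
    refine Finset.sum_congr rfl fun j _ => ?_
    rw [Polynomial.derivative_C_mul, aux_chain x₀ v]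
  have hLd : ∀ i, (L i).natDegree ≤ 1 := by
    intro i
    simp only [hL]
    compute_degree
  have hdeg : (Polynomial.derivative (Polynomial.derivative f)).natDegree < d := by
    suffices (Polynomial.derivative (Polynomial.derivative f)).natDegree ≤ d - 1 by omega
    rw [hf2]
    refine Polynomial.natDegree_sum_le_of_forall_le _ _ fun j _ => ?_
    refine (Polynomial.natDegree_C_mul_le _ _).trans ?_
    refine Polynomial.natDegree_sum_le_of_forall_le _ _ fun i _ => ?_
    refine (Polynomial.natDegree_C_mul_le _ _).trans ?_
    have := MvPolynomial.aeval_natDegree_le (pderiv i (pderiv j p)) (le_refl _) L hLd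
    have := hd i j
    omega
  have hcf : ConvexOn ℝ Set.univ (fun t => f.eval t) := by
    have := hconv.comp_affineMap (AffineMap.lineMap x₀ x : ℝ →ᵃ[ℝ] (Fin n → ℝ))
    rw [Set.preimage_univ] at this
    have hfun : (fun t => f.eval t) =
        (fun x : Fin n → ℝ => eval x p) ∘ (AffineMap.lineMap x₀ x : ℝ →ᵃ[ℝ] (Fin n → ℝ)) := by
      funext t
      rw [hf, aux_eval]
      simp only [Function.comp]
      congr 2
      funext i
      simp [AffineMap.lineMap_apply, hv]
      ring
    rw [hfun]
    exact this
  have key := aux_uni f hcf d hd2 hdeg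
  have z : (fun i => x₀ i + v i * 0) = x₀ := by funext i; simp
  have o : (fun i => x₀ i + v i * 1) = x := by funext i; simp [hv]
  have e0 : f.eval 0 = eval x₀ p := by rw [hf, aux_eval, z]
  have e1 : f.eval 1 = eval x p := by rw [hf, aux_eval, o]
  have e2 : (Polynomial.derivative f).eval 0 = ∑ i, eval x₀ (pderiv i p) * v i := by
    rw [hf1, Polynomial.eval_finsetSum]
    refine Finset.sum_congr rfl fun i _ => ?_
    rw [Polynomial.eval_mul, aux_eval, z, Polynomial.eval_C, mul_comm]
  have e3 : (Polynomial.derivative (Polynomial.derivative f)).eval 0 =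
      ∑ i, ∑ j, v i * eval x₀ (pderiv i (pderiv j p)) * v j := by
    rw [hf2, Polynomial.eval_finsetSum, Finset.sum_comm]
    refine Finset.sum_congr rfl fun j _ => ?_
    rw [Polynomial.eval_mul, Polynomial.eval_finsetSum, Polynomial.eval_C, Finset.mul_sum]
    refine Finset.sum_congr rfl fun i _ => ?_
    rw [Polynomial.eval_mul, aux_eval, z, Polynomial.eval_C]
    ring
  rw [e0, e1, e2, e3] at key
  linarith

theorem aux_quad (n : ℕ) (A : Matrix (Fin n) (Fin n) ℝ) (hA : A.PosDef) :
    ∃ c > 0, ∀ v : Fin n → ℝ, c * ‖v‖ ^ 2 ≤ ∑ i, ∑ j, v i * A i j * v j := by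
  have hpos : ∀ v : Fin n → ℝ, v ≠ 0 → 0 < ∑ i, ∑ j, v i * A i j * v j := by
    intro v hv
    have := hA.dotProduct_mulVec_pos hv
    simpa [dotProduct, Matrix.mulVec, Finset.mul_sum, mul_assoc] using this
  rcases (Metric.sphere (0 : Fin n → ℝ) 1).eq_empty_or_nonempty with he | hne
  · refine ⟨1, one_pos, fun v => ?_⟩
    by_cases hv : v = 0
    · simp [hv]
    · have : (‖v‖⁻¹ • v) ∈ Metric.sphere (0 : Fin n → ℝ) 1 := by
        simp [norm_smul, hv]
      rw [he] at this
      exact this.elim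
  · obtain ⟨u, hu, hmin⟩ := (isCompact_sphere (0 : Fin n → ℝ) 1).exists_isMinOn hne
      (f := fun v => ∑ i, ∑ j, v i * A i j * v j) (by fun_prop)
    refine ⟨∑ i, ∑ j, u i * A i j * u j, hpos u ?_, fun v => ?_⟩
    · rintro rfl
      simp at hu
    by_cases hv : v = 0
    · simp [hv]
    · have hm : (‖v‖⁻¹ • v) ∈ Metric.sphere (0 : Fin n → ℝ) 1 := by
        simp [norm_smul, hv]
      have h := hmin hm
      have hn : 0 < ‖v‖ := norm_pos_iff.mpr hv
      have e : ∑ i, ∑ j, (‖v‖⁻¹ • v) i * A i j * (‖v‖⁻¹ • v) j =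
          (∑ i, ∑ j, v i * A i j * v j) / ‖v‖ ^ 2 := by
        rw [Finset.sum_div]
        refine Finset.sum_congr rfl fun i _ => ?_
        rw [Finset.sum_div]
        refine Finset.sum_congr rfl fun j _ => ?_
        simp only [Pi.smul_apply, smul_eq_mul]
        field_simp
      simp only [Set.mem_ofPred_eq] at h
      rw [e, le_div_iff₀ (by positivity)] at h
      exact h

/-- A convex polynomial whose Hessian is positive definite at a point `x₀` is coercive;
in fact it is bounded below by the coercive quadratic
`x ↦ p(x₀) + ∇p(x₀)ᵀ(x−x₀) + (1/(4(d²−1))) (x−x₀)ᵀ∇²p(x₀)(x−x₀)`,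
for `d` any even integer greater than the degree of the entries of the Hessian of `p`. -/
theorem stmt3 (n : ℕ) (p : MvPolynomial (Fin n) ℝ)
    (hconv : ConvexOn ℝ Set.univ (fun x : Fin n → ℝ => eval x p))
    (x₀ : Fin n → ℝ)
    (hhess : (Matrix.of fun i j : Fin n =>
        eval x₀ (pderiv i (pderiv j p))).PosDef)
    (d : ℕ) (hd_even : Even d)
    (hd : ∀ i j : Fin n, (pderiv i (pderiv j p)).totalDegree < d) :
    (∀ x : Fin n → ℝ,
      eval x₀ p + (∑ i, eval x₀ (pderiv i p) * (x i - x₀ i))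
        + (1 / (4 * ((d:ℝ)^2 - 1))) *
          (∑ i, ∑ j, (x i - x₀ i) * eval x₀ (pderiv i (pderiv j p)) * (x j - x₀ j))
      ≤ eval x p)
    ∧ Filter.Tendsto (fun x : Fin n → ℝ => eval x p)
        (Filter.cocompact (Fin n → ℝ)) Filter.atTop := by
  rcases Nat.eq_zero_or_pos n with rfl | hn
  · refine ⟨fun x => ?_, ?_⟩
    · rw [Subsingleton.elim x x₀]
      simp
    · simp [Filter.cocompact_eq_bot]
  have hd2 : 2 ≤ d := by
    have := hd ⟨0, hn⟩ ⟨0, hn⟩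
    obtain ⟨k, rfl⟩ := hd_even
    omega
  have hlow := aux_lower n p hconv x₀ d hd2 hd
  refine ⟨hlow, ?_⟩
  obtain ⟨c, hc, hq⟩ := aux_quad n _ hhess
  have hdr : (2:ℝ) ≤ d := by exact_mod_cast hd2
  have hk : (0:ℝ) < 1 / (4 * ((d:ℝ)^2 - 1)) := one_div_pos.mpr (by nlinarith)
  set k : ℝ := 1 / (4 * ((d:ℝ)^2 - 1)) with hkdef
  set B : ℝ := ∑ i, |eval x₀ (pderiv i p)| with hB
  have hbound : ∀ x : Fin n → ℝ,
      eval x₀ p + ‖x - x₀‖ * (k * c * ‖x - x₀‖ - B) ≤ eval x p := by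
    intro x
    have h1 := hlow x
    have h2 := hq (x - x₀)
    simp only [Matrix.of_apply, Pi.sub_apply] at h2
    have h3 := mul_le_mul_of_nonneg_left h2 hk.le
    have h4 : -(B * ‖x - x₀‖) ≤ ∑ i, eval x₀ (pderiv i p) * (x i - x₀ i) := by
      rw [hB, Finset.sum_mul, ← Finset.sum_neg_distrib]
      refine Finset.sum_le_sum fun i _ => ?_
      have h5 : |x i - x₀ i| ≤ ‖x - x₀‖ := norm_le_pi_norm (x - x₀) i
      have h6 := neg_abs_le (eval x₀ (pderiv i p) * (x i - x₀ i))
      rw [abs_mul] at h6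
      have h7 := mul_le_mul_of_nonneg_left h5 (abs_nonneg (eval x₀ (pderiv i p)))
      linarith
    nlinarith
  refine Filter.tendsto_atTop_mono hbound ?_
  have hnorm : Filter.Tendsto (fun x : Fin n → ℝ => ‖x - x₀‖)
      (Filter.cocompact (Fin n → ℝ)) Filter.atTop :=
    tendsto_norm_cocompact_atTop.comp
      (Homeomorph.subRight x₀).isClosedEmbedding.tendsto_cocompact
  refine Filter.tendsto_atTop_add_const_left _ _ ?_
  refine hnorm.atTop_mul_atTop₀ ?_
  exact Filter.tendsto_atTop_add_const_right _ _ (hnorm.const_mul_atTop (mul_pos hk hc))
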